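/- arXiv:2503.05548 — 4 statements merged into one kernel-verified Lean document; each statement's English description precedes it below -/
import Mathlib

section
/- For all nonnegative integers p, h and every positive integer Δ there exists an integer C ≥ 1 with the following property: for every integer k ≥ 1 there exist integers m, n with k ≤ m ≤ C·k and n ≤ C·k, an (h+m) × (p+n) integer block matrix A = [[C', W], [T, M]] in which all entries of C' ∈ ℤ^{h×p}, W ∈ ℤ^{h×n}, T ∈ ℤ^{m×p} lie in {0, 1, Δ} and every column of M ∈ ℤ^{m×n} has 1-norm at most 2, a right-hand side b ∈ ℤ^{h+m}, and a point x* ∈ ℝ^{p+n} with x* ≥ 0 and Ax* = b that is an extreme point of the polyhedron {x ∈ ℝ^{p+n} : Ax = b, x ≥ 0}, such that the set {x ∈ ℤ^{p+n} : Ax = b, x ≥ 0} is nonempty and every x in this set satisfies ‖x − x*‖_∞ ≥ k·(Δ·k)^{p+h}. -/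
open Matrix BigOperators

namespace Prox

/-- local columns: `y`, `s`, `r` -/
abbrev Col (p h K : ℕ) := Fin K ⊕ (Fin (p+1) × Fin K) ⊕ (Fin (h+1) × Fin (K+1))
/-- local rows: gadget, sum, copy, path -/
abbrev Row (p h K : ℕ) := Fin K ⊕ Fin (p+1) ⊕ (Fin p × Fin K) ⊕ (Fin (h+1) × Fin K)

def MM (p h K : ℕ) : Matrix (Row p h K) (Col p h K) ℤ
  | .inl i, .inl i' => if i' = i then 2 else 0
  | .inl i, .inr (.inl (j, i')) => if j = 0 then (if i' = i then 1 else 0) else 0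
  | .inl _, .inr (.inr _) => 0
  | .inr (.inl _), .inl _ => 0
  | .inr (.inl j), .inr (.inl (j', _)) => if j' = j then 1 else 0
  | .inr (.inl j), .inr (.inr (l, i)) =>
      if l = 0 then (if i = 0 then (if j = Fin.last p then 1 else 0) else 0) else 0
  | .inr (.inr (.inl _)), .inl _ => 0
  | .inr (.inr (.inl (j, i))), .inr (.inl (j', i')) =>
      if j' = j.succ then (if i' = i then 1 else 0) else 0
  | .inr (.inr (.inl _)), .inr (.inr _) => 0
  | .inr (.inr (.inr _)), .inl _ => 0
  | .inr (.inr (.inr _)), .inr (.inl _) => 0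
  | .inr (.inr (.inr (l, i))), .inr (.inr (l', i')) =>
      if l' = l then ((if i' = i.castSucc then 1 else 0) - (if i' = i.succ then 1 else 0)) else 0

def TT (p h K : ℕ) : Matrix (Row p h K) (Fin p) ℤ
  | .inl _, _ => 0
  | .inr (.inl j), j' => if j = j'.castSucc then 1 else 0
  | .inr (.inr (.inl (j, _))), j' => if j' = j then 1 else 0
  | .inr (.inr (.inr _)), _ => 0

def WW (p h K : ℕ) : Matrix (Fin h) (Col p h K) ℤ
  | _, .inl _ => 0
  | _, .inr (.inl _) => 0
  | l, .inr (.inr (l', i')) =>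
      (if l' = l.castSucc then (if i' = 0 then 0 else 1) else 0)
      + (if l' = l.succ then (if i' = 0 then 1 else 0) else 0)

def bb (p h K : ℕ) : Fin h ⊕ Row p h K → ℤ
  | .inl l => (K:ℤ)^(p+2+(l:ℕ))
  | .inr (.inl _) => 1
  | .inr (.inr (.inl j)) => (K:ℤ)^((j:ℕ)+1)
  | .inr (.inr (.inr (.inl (j, _)))) => (K:ℤ)^((j:ℕ)+1)
  | .inr (.inr (.inr (.inr _))) => 0

abbrev AA (p h K : ℕ) : Matrix (Fin h ⊕ Row p h K) (Fin p ⊕ Col p h K) ℤ :=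
  Matrix.fromBlocks 0 (WW p h K) (TT p h K) (MM p h K)

/-- the value of row `j` of the sum rows: the extra variable -/
def extra {p h K : ℕ} (x : Fin p ⊕ Col p h K → ℝ) (j : Fin (p+1)) : ℝ :=
  if hj : (j:ℕ) < p then x (.inl ⟨j, hj⟩) else x (.inr (.inr (.inr (0, 0))))

structure Sys (p h K : ℕ) (x : Fin p ⊕ Col p h K → ℝ) : Prop where
  gad : ∀ i : Fin K, 2 * x (.inr (.inl i)) + x (.inr (.inr (.inl (0, i)))) = 1
  sum : ∀ j : Fin (p+1), (∑ i : Fin K, x (.inr (.inr (.inl (j, i))))) + extra x j = (K:ℝ)^((j:ℕ)+1)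
  copy : ∀ (j : Fin p) (i : Fin K),
    x (.inl j) + x (.inr (.inr (.inl (j.succ, i)))) = (K:ℝ)^((j:ℕ)+1)
  path : ∀ (l : Fin (h+1)) (i : Fin K),
    x (.inr (.inr (.inr (l, i.castSucc)))) = x (.inr (.inr (.inr (l, i.succ))))
  wrow : ∀ l : Fin h, (∑ i : Fin K, x (.inr (.inr (.inr (l.castSucc, i.succ)))))
    + x (.inr (.inr (.inr (l.succ, 0)))) = (K:ℝ)^(p+2+(l:ℕ))

lemma extra_sum {p h K : ℕ} (x : Fin p ⊕ Col p h K → ℝ) (j : Fin (p+1)) :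
    (∑ j' : Fin p, if j = j'.castSucc then x (.inl j') else 0)
      + (if j = Fin.last p then x (.inr (.inr (.inr (0, 0)))) else 0) = extra x j := by
  unfold extra
  refine Fin.lastCases ?_ (fun j => ?_) j
  · have : ∀ j' : Fin p, Fin.last p ≠ j'.castSucc := fun j' => (Fin.castSucc_lt_last j').ne'
    simp [this]
  · have h1 : j.castSucc ≠ Fin.last p := (Fin.castSucc_lt_last j).ne
    simp [h1]

lemma sys_iff (p h K : ℕ) (x : Fin p ⊕ Col p h K → ℝ) :
    ((AA p h K).map (Int.cast : ℤ → ℝ)).mulVec x = (fun i => (bb p h K i : ℝ)) ↔ Sys p h K x := by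
  have e1 : ∀ i : Fin K, ((AA p h K).map (Int.cast : ℤ → ℝ)).mulVec x (.inr (.inl i))
      = 2 * x (.inr (.inl i)) + x (.inr (.inr (.inl (0, i)))) := by
    intro i
    simp [Matrix.mulVec, dotProduct, Fintype.sum_prod_type, MM, TT, ite_mul]
  have e2 : ∀ j : Fin (p+1), ((AA p h K).map (Int.cast : ℤ → ℝ)).mulVec x (.inr (.inr (.inl j)))
      = (∑ i : Fin K, x (.inr (.inr (.inl (j, i))))) + extra x j := by
    intro j
    rw [← extra_sum]
    simp only [Matrix.mulVec, dotProduct, Fintype.sum_prod_type, MM, TT, Fintype.sum_sum_type,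
      Matrix.map_apply, Matrix.fromBlocks_apply₂₁, Matrix.fromBlocks_apply₂₂]
    rw [Finset.sum_comm (s := (Finset.univ : Finset (Fin (p+1))))]
    simp [ite_mul]
    ring
  have e3 : ∀ (j : Fin p) (i : Fin K),
      ((AA p h K).map (Int.cast : ℤ → ℝ)).mulVec x (.inr (.inr (.inr (.inl (j, i)))))
      = x (.inl j) + x (.inr (.inr (.inl (j.succ, i)))) := by
    intro j i
    simp [Matrix.mulVec, dotProduct, Fintype.sum_prod_type, MM, TT, ite_mul]
  have e4 : ∀ (l : Fin (h+1)) (i : Fin K),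
      ((AA p h K).map (Int.cast : ℤ → ℝ)).mulVec x (.inr (.inr (.inr (.inr (l, i)))))
      = x (.inr (.inr (.inr (l, i.castSucc)))) - x (.inr (.inr (.inr (l, i.succ)))) := by
    intro l i
    simp only [Matrix.mulVec, dotProduct, Fintype.sum_prod_type, MM, TT, Fintype.sum_sum_type,
      Matrix.map_apply, Matrix.fromBlocks_apply₂₁, Matrix.fromBlocks_apply₂₂]
    rw [Finset.sum_comm (s := (Finset.univ : Finset (Fin (h+1))))]
    simp [ite_mul, sub_mul]
  have e5 : ∀ l : Fin h, ((AA p h K).map (Int.cast : ℤ → ℝ)).mulVec x (.inl l)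
      = (∑ i : Fin K, x (.inr (.inr (.inr (l.castSucc, i.succ)))))
        + x (.inr (.inr (.inr (l.succ, 0)))) := by
    intro l
    simp only [Matrix.mulVec, dotProduct, Fintype.sum_prod_type, WW, Fintype.sum_sum_type,
      Matrix.map_apply, Matrix.fromBlocks_apply₁₁, Matrix.fromBlocks_apply₁₂]
    rw [Finset.sum_comm (s := (Finset.univ : Finset (Fin (h+1))))]
    simp [ite_mul, add_mul, Finset.sum_add_distrib, Fin.sum_univ_succ (n := K)]
    ring
  constructor
  · intro H
    have H' := fun i => congrFun H i
    refine ⟨fun i => ?_, fun j => ?_, fun j i => ?_, fun l i => ?_, fun l => ?_⟩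
    · rw [← e1, H']; simp [bb]
    · rw [← e2, H']; simp [bb]
    · rw [← e3, H']; simp [bb]
    · rw [← sub_eq_zero, ← e4, H']; simp [bb]
    · rw [← e5, H']; simp [bb]
  · intro H
    funext i
    rcases i with l | i | j | ⟨j, i⟩ | ⟨l, i⟩
    · rw [e5, H.wrow]; simp [bb]
    · rw [e1, H.gad]; simp [bb]
    · rw [e2, H.sum]; simp [bb]
    · rw [e3, H.copy]; simp [bb]
    · rw [e4, H.path]; simp [bb]

/-- The unique solution with all `z` equal to `c`. -/
noncomputable def XX (p h K : ℕ) (c : ℝ) : Fin p ⊕ Col p h K → ℝ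
  | .inl j => (1 - c) * (K:ℝ)^((j:ℕ)+1)
  | .inr (.inl _) => (1 - c) / 2
  | .inr (.inr (.inl (j, _))) => c * (K:ℝ)^(j:ℕ)
  | .inr (.inr (.inr (l, _))) => (if Even (l:ℕ) then 1 - c else c) * (K:ℝ)^(p+1+(l:ℕ))

lemma sys_XX (p h K : ℕ) (c : ℝ) : Sys p h K (XX p h K c) := by
  refine ⟨fun i => ?_, fun j => ?_, fun j i => ?_, fun l i => ?_, fun l => ?_⟩
  · simp [XX]; ring
  · unfold extra
    split_ifs with hj
    · simp [XX]; ring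
    · have : (j:ℕ) = p := by omega
      simp [XX, this]; ring
  · simp [XX]; ring
  · simp [XX]
  · by_cases hl : Even (l:ℕ)
    · simp [XX, hl, Nat.even_add_one]; ring
    · simp [XX, hl, Nat.even_add_one]; ring

lemma sys_unique (p h K : ℕ) (c : ℝ) (x : Fin p ⊕ Col p h K → ℝ) (hx : Sys p h K x)
    (hz : ∀ i, x (.inr (.inr (.inl (0, i)))) = c) : x = XX p h K c := by
  have hs : ∀ (n : ℕ) (hn : n < p + 1) (i : Fin K),
      x (.inr (.inr (.inl (⟨n, hn⟩, i)))) = c * (K:ℝ)^n := by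
    intro n
    induction n with
    | zero => intro hn i; simpa using hz i
    | succ n ih =>
      intro hn i
      have h1 := hx.sum ⟨n, by omega⟩
      have h2 := hx.copy ⟨n, by omega⟩ i
      simp only [ih (by omega), extra, dif_pos (show n < p by omega)] at h1
      simp only [Fin.succ_mk] at h2
      simp only [Finset.sum_const, Finset.card_univ, Fintype.card_fin, nsmul_eq_mul] at h1
      linear_combination h2 - h1
  have hg : ∀ j : Fin p, x (.inl j) = (1 - c) * (K:ℝ)^((j:ℕ)+1) := by
    intro j
    have h1 := hx.sum j.castSucc
    have : ∀ i, x (.inr (.inr (.inl (j.castSucc, i)))) = c * (K:ℝ)^(j:ℕ) :=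
      fun i => hs j (by omega) i
    simp [extra, this] at h1
    linear_combination h1
  have hr0 : x (.inr (.inr (.inr (0, 0)))) = (1 - c) * (K:ℝ)^(p+1) := by
    have h1 := hx.sum (Fin.last p)
    have : ∀ i, x (.inr (.inr (.inl (Fin.last p, i)))) = c * (K:ℝ)^p :=
      fun i => hs p (by omega) i
    simp [extra, this] at h1
    linear_combination h1
  have hpath : ∀ (l : Fin (h+1)) (i : Fin (K+1)),
      x (.inr (.inr (.inr (l, i)))) = x (.inr (.inr (.inr (l, 0)))) := by
    intro l i
    induction i using Fin.induction with
    | zero => rfl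
    | succ i ih => rw [← hx.path, ih]
  have hr : ∀ l : Fin (h+1), x (.inr (.inr (.inr (l, 0))))
      = (if Even (l:ℕ) then 1 - c else c) * (K:ℝ)^(p+1+(l:ℕ)) := by
    intro l
    induction l using Fin.induction with
    | zero => simpa using hr0
    | succ l ih =>
      have h1 := hx.wrow l
      simp only [hpath l.castSucc (Fin.succ _), ih] at h1
      by_cases hl : Even (l:ℕ)
      · simp [hl, Nat.even_add_one] at h1 ⊢
        linear_combination h1
      · simp [hl, Nat.even_add_one] at h1 ⊢
        linear_combination h1
  funext j
  rcases j with j | i | ⟨j, i⟩ | ⟨l, i⟩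
  · exact hg j
  · have := hx.gad i
    rw [hz] at this
    simp only [XX]; linarith
  · exact hs j j.2 i
  · rw [hpath, hr]; rfl

lemma colnorm (p h K : ℕ) (j : Col p h K) : ∑ i, |MM p h K i j| ≤ 2 := by
  rcases j with i | ⟨j, i⟩ | ⟨l, i⟩
  · simp [MM, Fintype.sum_prod_type, apply_ite abs]
  · simp only [Fintype.sum_sum_type, Fintype.sum_prod_type, MM, apply_ite abs]
    refine Fin.cases ?_ (fun j => ?_) j
    · have : ∀ j : Fin p, (0 : Fin (p+1)) ≠ j.succ := fun j => (Fin.succ_ne_zero j).symm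
      simp [this]
    · rw [Finset.sum_comm (s := (Finset.univ : Finset (Fin p)))]
      simp
  · simp only [Fintype.sum_sum_type, Fintype.sum_prod_type, MM, apply_ite abs]
    rw [Finset.sum_comm (s := (Finset.univ : Finset (Fin (h+1))))]
    have key : ∀ i' : Fin K, |(if i = i'.castSucc then (1:ℤ) else 0) - (if i = i'.succ then 1 else 0)|
        ≤ (if i = i'.castSucc then (1:ℤ) else 0) + (if i = i'.succ then 1 else 0) := by
      intro i'
      split_ifs <;> simp
    have k2 : ∑ i' : Fin K, |(if i = i'.castSucc then (1:ℤ) else 0) - (if i = i'.succ then 1 else 0)|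
        ≤ 1 + (if i = 0 then 0 else 1) := by
      refine (Finset.sum_le_sum fun i' _ => key i').trans ?_
      rw [Finset.sum_add_distrib]
      refine add_le_add ?_ ?_
      · refine Fin.lastCases ?_ (fun i => ?_) i
        · have : ∀ j' : Fin K, Fin.last K ≠ j'.castSucc := fun j' => (Fin.castSucc_lt_last j').ne'
          simp [this]
        · simp
      · refine Fin.cases ?_ (fun i => ?_) i
        · have : ∀ j : Fin K, (0 : Fin (K+1)) ≠ j.succ := fun j => (Fin.succ_ne_zero j).symm
          simp [this]
        · simp
    have k3 : (∑ j : Fin (p+1), if l = 0 then (if i = 0 then (if j = Fin.last p then |(1:ℤ)| else |0|) else |0|) else |0|)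
        ≤ (if i = 0 then 1 else 0) := by
      split_ifs <;> simp
    simp only [Finset.sum_ite_eq, Finset.mem_univ, if_true, abs_zero, Finset.sum_const_zero] at k3 ⊢
    split_ifs at k2 k3 ⊢ <;> simp at k3 ⊢ <;> linarith

end Prox

open Prox in
theorem statement7 (p h : ℕ) (Δ : ℕ) (hΔ : 1 ≤ Δ) :
    ∃ C : ℕ, 1 ≤ C ∧ ∀ k : ℕ, 1 ≤ k →
      ∃ m n : ℕ, k ≤ m ∧ m ≤ C * k ∧ n ≤ C * k ∧
      ∃ (C' : Matrix (Fin h) (Fin p) ℤ) (W : Matrix (Fin h) (Fin n) ℤ)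
        (T : Matrix (Fin m) (Fin p) ℤ) (M : Matrix (Fin m) (Fin n) ℤ),
        (∀ i j, C' i j = 0 ∨ C' i j = 1 ∨ C' i j = (Δ : ℤ)) ∧
        (∀ i j, W i j = 0 ∨ W i j = 1 ∨ W i j = (Δ : ℤ)) ∧
        (∀ i j, T i j = 0 ∨ T i j = 1 ∨ T i j = (Δ : ℤ)) ∧
        (∀ j, (∑ i, |M i j|) ≤ 2) ∧
        ∃ (b : Fin h ⊕ Fin m → ℤ) (xstar : Fin p ⊕ Fin n → ℝ),
          (∀ j, 0 ≤ xstar j) ∧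
          ((Matrix.fromBlocks C' W T M).map (Int.cast : ℤ → ℝ)).mulVec xstar
            = (fun i => (b i : ℝ)) ∧
          xstar ∈ Set.extremePoints ℝ
            {x : Fin p ⊕ Fin n → ℝ |
              ((Matrix.fromBlocks C' W T M).map (Int.cast : ℤ → ℝ)).mulVec x
                = (fun i => (b i : ℝ)) ∧ ∀ j, 0 ≤ x j} ∧
          (∃ x : Fin p ⊕ Fin n → ℤ,
            (Matrix.fromBlocks C' W T M).mulVec x = b ∧ ∀ j, 0 ≤ x j) ∧
          ∀ x : Fin p ⊕ Fin n → ℤ,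
            (Matrix.fromBlocks C' W T M).mulVec x = b → (∀ j, 0 ≤ x j) →
            ∃ j, (k : ℝ) * ((Δ : ℝ) * (k : ℝ)) ^ (p + h) ≤ |(x j : ℝ) - xstar j| := by
  refine ⟨(2*p+2*h+10)*Δ, by nlinarith, fun k hk => ?_⟩
  obtain ⟨K, hK⟩ : ∃ K, K = Δ * k := ⟨_, rfl⟩
  have hkK : k ≤ K := by rw [hK]; nlinarith
  have hK1 : 1 ≤ K := hk.trans hkK
  obtain ⟨m, hm⟩ : ∃ m, m = Fintype.card (Row p h K) := ⟨_, rfl⟩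
  obtain ⟨n, hn⟩ : ∃ n, n = Fintype.card (Col p h K) := ⟨_, rfl⟩
  let eR : Fin m ≃ Row p h K := (Fintype.equivFinOfCardEq hm.symm).symm
  let eC : Fin n ≃ Col p h K := (Fintype.equivFinOfCardEq hn.symm).symm
  have hm' : m = K + ((p+1) + (p * K + (h+1)*K)) := by rw [hm]; simp
  have hn' : n = K + ((p+1)*K + (h+1)*(K+1)) := by rw [hn]; simp
  let fR : Fin h ⊕ Fin m ≃ Fin h ⊕ Row p h K := Equiv.sumCongr (Equiv.refl _) eR
  let fC : Fin p ⊕ Fin n ≃ Fin p ⊕ Col p h K := Equiv.sumCongr (Equiv.refl _) eC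
  have hA : Matrix.fromBlocks (0 : Matrix (Fin h) (Fin p) ℤ) ((WW p h K).submatrix id eC)
      ((TT p h K).submatrix eR id) ((MM p h K).submatrix eR eC) = (AA p h K).submatrix fR fC := by
    ext i j
    rcases i with i | i <;> rcases j with j | j <;> rfl
  -- real solutions
  have hsol : ∀ x : Fin p ⊕ Fin n → ℝ,
      (((AA p h K).submatrix fR fC).map (Int.cast : ℤ → ℝ)).mulVec x
        = (fun i => ((bb p h K ∘ fR) i : ℝ)) ↔ Sys p h K (x ∘ fC.symm) := by
    intro x
    rw [← sys_iff, ← Matrix.submatrix_map, Matrix.submatrix_mulVec_equiv]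
    constructor
    · intro H
      funext i
      have := congrFun H (fR.symm i)
      simpa using this
    · intro H
      funext i
      have := congrFun H (fR i)
      simpa using this
  have hsolZ : ∀ x : Fin p ⊕ Fin n → ℤ,
      ((AA p h K).submatrix fR fC).mulVec x = bb p h K ∘ fR ↔
        Sys p h K ((fun j => (x j : ℝ)) ∘ fC.symm) := by
    intro x
    rw [← hsol]
    have e : ∀ i, (((AA p h K).submatrix fR fC).map (Int.cast : ℤ → ℝ)).mulVec
        (fun j => (x j : ℝ)) i = ((((AA p h K).submatrix fR fC).mulVec x i : ℤ) : ℝ) := by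
      intro i
      simp only [Matrix.mulVec, dotProduct, Matrix.map_apply]
      push_cast
      rfl
    constructor
    · intro H
      funext i
      rw [e, H]
    · intro H
      funext i
      have := congrFun H i
      rw [e] at this
      exact_mod_cast this
  have hX0 : ∀ j, 0 ≤ XX p h K 0 j := by
    intro j
    rcases j with j | i | ⟨j, i⟩ | ⟨l, i⟩ <;> simp only [XX]
    · positivity
    · norm_num
    · simp
    · split_ifs <;> simp
  let XZ : Fin p ⊕ Col p h K → ℤ := fun j => match j with
    | .inl _ => 0
    | .inr (.inl _) => 0
    | .inr (.inr (.inl (j, _))) => (K:ℤ)^(j:ℕ)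
    | .inr (.inr (.inr (l, _))) => (if Even (l:ℕ) then 0 else 1) * (K:ℤ)^(p+1+(l:ℕ))
  have hXZ : ∀ j, (XZ j : ℝ) = XX p h K 1 j := by
    intro j
    rcases j with j | i | ⟨j, i⟩ | ⟨l, i⟩ <;> simp [XX, XZ]
  have hXZ0 : ∀ j, 0 ≤ XZ j := by
    intro j
    rcases j with j | i | ⟨j, i⟩ | ⟨l, i⟩ <;> simp only [XZ]
    · exact le_rfl
    · exact le_rfl
    · positivity
    · split_ifs <;> positivity
  have hstar : Sys p h K ((XX p h K 0 ∘ fC) ∘ fC.symm) := by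
    have : (XX p h K 0 ∘ fC) ∘ fC.symm = XX p h K 0 := by funext j; simp
    rw [this]; exact sys_XX p h K 0
  refine ⟨m, n, by rw [hm']; omega, ?_, ?_, 0, (WW p h K).submatrix id eC,
    (TT p h K).submatrix eR id, (MM p h K).submatrix eR eC, fun i j => Or.inl rfl, ?_, ?_, ?_, ?_⟩
  · rw [mul_assoc, ← hK, hm']; nlinarith
  · rw [mul_assoc, ← hK, hn']; nlinarith
  · intro i j
    simp only [Matrix.submatrix_apply]
    rcases eC j with j | ⟨j, i⟩ | ⟨l, i'⟩
    · left; rfl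
    · left; rfl
    · simp only [WW]
      split_ifs <;> simp
  · intro i j
    simp only [Matrix.submatrix_apply]
    rcases eR i with i | j | ⟨j, i⟩ | ⟨l, i⟩
    · left; rfl
    · simp only [TT]; split_ifs <;> simp
    · simp only [TT]; split_ifs <;> simp
    · left; rfl
  · intro j
    simp only [Matrix.submatrix_apply]
    rw [Equiv.sum_comp eR (fun i => |MM p h K i (eC j)|)]
    exact colnorm p h K _
  rw [hA]
  refine ⟨bb p h K ∘ fR, XX p h K 0 ∘ fC, fun j => hX0 _, (hsol _).2 hstar, ?_, ?_, ?_⟩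
  · rw [mem_extremePoints]
    refine ⟨⟨(hsol _).2 hstar, fun j => hX0 _⟩, ?_⟩
    rintro x ⟨hx, hx0⟩ y ⟨hy, hy0⟩ ⟨a, b, ha, hb, hab, hxy⟩
    rw [hsol] at hx hy
    have hz : ∀ i, x (fC.symm (.inr (.inr (.inl (0, i))))) = 0
        ∧ y (fC.symm (.inr (.inr (.inl (0, i))))) = 0 := by
      intro i
      have h1 := congrFun hxy (fC.symm (.inr (.inr (.inl (0, i)))))
      have hx1 := hx0 (fC.symm (.inr (.inr (.inl (0, i)))))
      have hy1 := hy0 (fC.symm (.inr (.inr (.inl (0, i)))))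
      simp only [Pi.add_apply, Pi.smul_apply, smul_eq_mul, Function.comp_apply,
        Equiv.apply_symm_apply, XX, zero_mul] at h1
      have h2 := mul_nonneg ha.le hx1
      have h3 := mul_nonneg hb.le hy1
      constructor
      · have : a * x (fC.symm (.inr (.inr (.inl (0, i))))) = 0 := by linarith
        exact (mul_eq_zero.1 this).resolve_left ha.ne'
      · have : b * y (fC.symm (.inr (.inr (.inl (0, i))))) = 0 := by linarith
        exact (mul_eq_zero.1 this).resolve_left hb.ne'
    have ux := sys_unique p h K 0 _ hx (fun i => (hz i).1)
    have uy := sys_unique p h K 0 _ hy (fun i => (hz i).2)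
    constructor
    · rw [← ux]; funext j; simp
    · rw [← uy]; funext j; simp
  · refine ⟨XZ ∘ fC, (hsolZ _).2 ?_, fun j => hXZ0 _⟩
    have : (fun j => (((XZ ∘ fC) j : ℤ) : ℝ)) ∘ fC.symm = XX p h K 1 := by
      funext j; simp [hXZ]
    rw [this]; exact sys_XX p h K 1
  · intro x hx hx0
    rw [hsolZ] at hx
    have u := sys_unique p h K 1 _ hx (fun i => by
      have h1 := hx.gad i
      simp only [Function.comp_apply] at h1 ⊢
      have h2 := hx0 (fC.symm (.inr (.inl i)))
      have h3 := hx0 (fC.symm (.inr (.inr (.inl (0, i)))))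
      have h4 : 2 * x (fC.symm (.inr (.inl i))) + x (fC.symm (.inr (.inr (.inl (0, i))))) = 1 := by
        exact_mod_cast h1
      have h5 : x (fC.symm (.inr (.inr (.inl (0, i))))) = 1 := by omega
      rw [h5]; norm_num)
    refine ⟨fC.symm (.inr (.inr (.inr (Fin.last h, 0)))), ?_⟩
    have h1 := congrFun u (.inr (.inr (.inr (Fin.last h, 0))))
    simp only [Function.comp_apply] at h1
    rw [h1]
    have hKR : (Δ:ℝ) * k = K := by rw [hK]; push_cast; rfl
    have hkR : (k:ℝ) ≤ K := by exact_mod_cast hkK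
    have h2 : |XX p h K 1 (.inr (.inr (.inr (Fin.last h, 0))))
        - (XX p h K 0 ∘ fC) (fC.symm (.inr (.inr (.inr (Fin.last h, 0)))))| = (K:ℝ)^(p+1+h) := by
      simp only [Function.comp_apply, Equiv.apply_symm_apply, XX, Fin.val_last]
      split_ifs <;> simp
    rw [h2, hKR]
    calc (k:ℝ) * (K:ℝ)^(p+h) ≤ K * (K:ℝ)^(p+h) := by gcongr
      _ = (K:ℝ)^(p+1+h) := by ring
end

section
/- Let n ≥ 1 and let M ∈ ℤ^{n×n} be a square integer matrix in which every column has 1-norm at most 2, i.e., Σ_i |M_{ij}| ≤ 2 for every column j. Then either det M = 0 or |det M| = 2^t for some nonnegative integer t. -/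
open Matrix BigOperators

theorem aux_pivot {n : ℕ} (A : Matrix (Fin (n+1)) (Fin (n+1)) ℤ) (i : Fin (n+1))
    (h0 : ∀ k, k ≠ i → A k 0 = 0) (hi : |A i 0| = 1 ∨ |A i 0| = 2)
    (ih : (A.submatrix i.succAbove Fin.succ).det = 0 ∨
      ∃ t : ℕ, |(A.submatrix i.succAbove Fin.succ).det| = 2 ^ t) :
    A.det = 0 ∨ ∃ t : ℕ, |A.det| = 2 ^ t := by
  have hd : A.det = (-1) ^ (i : ℕ) * A i 0 * (A.submatrix i.succAbove Fin.succ).det := by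
    rw [Matrix.det_succ_column_zero]
    apply Finset.sum_eq_single i
    · intro k _ hk
      simp [h0 k hk]
    · simp
  rcases ih with h | ⟨t, h⟩
  · left
    rw [hd, h, mul_zero]
  · right
    have hd2 : |A.det| = |A i 0| * 2 ^ t := by
      rw [hd, abs_mul, abs_mul, h, abs_pow]
      simp
    rcases hi with hi | hi
    · exact ⟨t, by rw [hd2, hi, one_mul]⟩
    · exact ⟨t + 1, by rw [hd2, hi, pow_succ, mul_comm]⟩

theorem aux_main (n : ℕ) : ∀ (M : Matrix (Fin n) (Fin n) ℤ)
    (_ : ∀ j, (∑ i, |M i j|) ≤ 2), M.det = 0 ∨ ∃ t : ℕ, |M.det| = 2 ^ t := by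
  induction n with
  | zero =>
    intro M _
    right
    exact ⟨0, by simp⟩
  | succ n ih =>
    intro M hM
    by_cases hz : ∀ i, M i 0 = 0
    · left
      exact Matrix.det_eq_zero_of_column_eq_zero 0 hz
    by_cases h1 : ∃ i, |M i 0| = 1
    · obtain ⟨i, hi⟩ := h1
      have hsq : M i 0 * M i 0 = 1 := by
        rw [← abs_mul_abs_self, hi, one_mul]
      let c : Fin (n+1) → ℤ := fun k => if k = i then 0 else -(M i 0 * M k 0)
      let A : Matrix (Fin (n+1)) (Fin (n+1)) ℤ := fun k j => M k j + c k * M i j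
      have hA : A.det = M.det :=
        Matrix.det_eq_of_forall_row_eq_smul_add_const c i (by simp [c]) (fun _ _ => rfl)
      rw [← hA]
      apply aux_pivot A i
      · intro k hk
        simp only [A, c, if_neg hk]
        linear_combination (-(M k 0)) * hsq
      · left
        simpa [A, c] using hi
      · apply ih
        intro j
        have hc := hM 0
        have hj := hM j.succ
        rw [Fin.sum_univ_succAbove _ i] at hc hj
        rw [hi] at hc
        have hb : ∀ k : Fin n, |A.submatrix i.succAbove Fin.succ k j| ≤
            |M (i.succAbove k) j.succ| + |M (i.succAbove k) 0| * |M i j.succ| := by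
          intro k
          have hck : c (i.succAbove k) = -(M i 0 * M (i.succAbove k) 0) :=
            if_neg (Fin.succAbove_ne i k)
          change |M (i.succAbove k) j.succ + c (i.succAbove k) * M i j.succ| ≤ _
          rw [hck]
          refine (abs_add_le _ _).trans ?_
          rw [abs_mul, abs_neg, abs_mul, hi, one_mul]
        have hs := Finset.sum_le_sum (fun k (_ : k ∈ Finset.univ) => hb k)
        rw [Finset.sum_add_distrib, ← Finset.sum_mul] at hs
        nlinarith [abs_nonneg (M i j.succ)]
    · push Not at hz h1
      obtain ⟨i, hi⟩ := hz
      have hp : 0 < |M i 0| := abs_pos.mpr hi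
      have h2 : 2 ≤ |M i 0| := by
        have := h1 i
        omega
      have hc := hM 0
      rw [Fin.sum_univ_succAbove _ i] at hc
      have hnn : 0 ≤ ∑ k : Fin n, |M (i.succAbove k) 0| :=
        Finset.sum_nonneg (fun _ _ => abs_nonneg _)
      have hs0 : ∑ k : Fin n, |M (i.succAbove k) 0| = 0 := by omega
      apply aux_pivot M i
      · intro k hk
        obtain ⟨l, rfl⟩ := Fin.exists_succAbove_eq hk
        have := (Finset.sum_eq_zero_iff_of_nonneg (fun _ _ => abs_nonneg _)).mp hs0 l
          (Finset.mem_univ _)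
        exact abs_eq_zero.mp this
      · right
        omega
      · apply ih
        intro j
        have hj := hM j.succ
        rw [Fin.sum_univ_succAbove _ i] at hj
        have := abs_nonneg (M i j.succ)
        simp only [Matrix.submatrix_apply]
        linarith

theorem statement8 {n : ℕ} (hn : 1 ≤ n) (M : Matrix (Fin n) (Fin n) ℤ)
    (hM : ∀ j, (∑ i, |M i j|) ≤ 2) :
    M.det = 0 ∨ ∃ t : ℕ, |M.det| = 2 ^ t := by
  exact aux_main n M hM
end

section
/- Let R ∈ ℝ^{m×(p+n)} be a matrix of full row rank (rank R = m) of the block form R = [T | D], where T ∈ ℝ^{m×p} is arbitrary and D ∈ ℝ^{m×n} is block-diagonal with diagonal blocks D_1, …, D_ℓ, where D_k ∈ ℝ^{m_k×n_k}, Σ_{k=1}^ℓ m_k = m and Σ_{k=1}^ℓ n_k = n (all off-block entries of D are zero). Then Σ_{k=1}^ℓ max{m_k − n_k, 0} ≤ p. -/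
open Matrix BigOperators

theorem statement9 {p ℓ : ℕ} (mk nk : Fin ℓ → ℕ)
    (T : Matrix ((k : Fin ℓ) × Fin (mk k)) (Fin p) ℝ)
    (D : (k : Fin ℓ) → Matrix (Fin (mk k)) (Fin (nk k)) ℝ)
    (R : Matrix ((k : Fin ℓ) × Fin (mk k)) (Fin p ⊕ ((k : Fin ℓ) × Fin (nk k))) ℝ)
    (hR : ∀ i, R i = Sum.elim (T i) (Matrix.blockDiagonal' D i))
    (hrank : LinearIndependent ℝ (fun i => R i)) :
    ∑ k, (mk k - nk k) ≤ p := by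
  let V : (k : Fin ℓ) → Submodule ℝ (Fin (mk k) → ℝ) := fun k => LinearMap.ker (D k).vecMulLinear
  have hV : ∀ k, mk k - nk k ≤ Module.finrank ℝ (V k) := by
    intro k
    have h1 := LinearMap.finrank_range_add_finrank_ker (D k).vecMulLinear
    have h2 := Submodule.finrank_le (LinearMap.range (D k).vecMulLinear)
    simp only [Module.finrank_fintype_fun_eq_card, Fintype.card_fin] at h1 h2
    change _ ≤ Module.finrank ℝ (LinearMap.ker (D k).vecMulLinear)
    omega
  let flat : ((k : Fin ℓ) → V k) →ₗ[ℝ] (((k : Fin ℓ) × Fin (mk k)) → ℝ) :=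
    { toFun := fun v x => (v x.1 : Fin (mk x.1) → ℝ) x.2
      map_add' := fun _ _ => rfl
      map_smul' := fun _ _ => rfl }
  let f : ((k : Fin ℓ) → V k) →ₗ[ℝ] (Fin p → ℝ) := T.vecMulLinear ∘ₗ flat
  have hf : Function.Injective f := by
    rw [← LinearMap.ker_eq_bot, LinearMap.ker_eq_bot']
    intro v hv
    have h0 : ∑ i, flat v i • R i = 0 := by
      funext j
      rw [Finset.sum_apply]
      rcases j with j | ⟨k, j⟩
      · have := congrFun hv j
        simpa [f, Matrix.vecMul, dotProduct, hR] using this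
      · have hk : (v k : Fin (mk k) → ℝ) ᵥ* (D k) = 0 := (v k).2
        have := congrFun hk j
        simp only [Matrix.vecMul, dotProduct] at this
        rw [Fintype.sum_sigma, Finset.sum_eq_single k]
        · simpa [hR, flat, Matrix.blockDiagonal'_apply_eq] using this
        · intro b _ hb
          apply Finset.sum_eq_zero
          intro i _
          simp [hR, Matrix.blockDiagonal'_apply_ne D i j hb]
        · simp
    have h3 := Fintype.linearIndependent_iff.1 hrank (flat v) h0
    funext k
    ext i
    exact h3 ⟨k, i⟩
  have := LinearMap.finrank_le_finrank_of_injective hf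
  rw [Module.finrank_pi_fintype, Module.finrank_fintype_fun_eq_card, Fintype.card_fin] at this
  exact (Finset.sum_le_sum fun k _ => hV k).trans this
end

section
/- Let Δ ≥ 0, let W ∈ ℤ^{h×n} have all entries of absolute value at most Δ, and let M ∈ ℤ^{m×n} have every column of 1-norm at most 2. Let A ∈ ℤ^{(h+m)×n} be the matrix obtained by stacking W on top of M. Then every Graver basis element g of A satisfies ‖g‖_∞ ≤ 2·(2Δh(2m+1)+1)^h. -/
open Matrix BigOperators

/-- A Graver basis element of an integer matrix `A`: a nonzero integer kernel
vector `g` such that no other nonzero integer kernel vector is conformal to `g`. -/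
def IsGraverElement {s t : Type*} [Fintype s] [Fintype t]
    (A : Matrix s t ℤ) (g : t → ℤ) : Prop :=
  g ≠ 0 ∧ A.mulVec g = 0 ∧
  ∀ g' : t → ℤ, g' ≠ 0 → g' ≠ g → A.mulVec g' = 0 →
    ¬(∀ j, |g' j| ≤ |g j| ∧ 0 ≤ g' j * g j)


lemma st_dep {ι : Type*} [DecidableEq ι] {h : ℕ} (x : ι → Fin h → ℚ) (F : Finset ι)
    (hF : h + 1 < F.card) :
    ∃ μ : ι → ℚ, (∀ i, i ∉ F → μ i = 0) ∧ (∃ i ∈ F, μ i ≠ 0) ∧ (∑ i ∈ F, μ i = 0) ∧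
      ∀ a, ∑ i ∈ F, μ i * x i a = 0 := by
  have hnl : ¬ LinearIndependent ℚ (fun i : F => ((x i, 1) : (Fin h → ℚ) × ℚ)) := by
    intro hl
    have := hl.fintype_card_le_finrank
    simp at this
    omega
  rw [Fintype.not_linearIndependent_iff] at hnl
  obtain ⟨g, hg, ⟨i0, hi0⟩⟩ := hnl
  have h1 := congrArg Prod.fst hg
  have h2 := congrArg Prod.snd hg
  simp only [Prod.fst_sum, Prod.snd_sum, Prod.smul_mk, Prod.fst_zero, Prod.snd_zero,
    smul_eq_mul, mul_one] at h1 h2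
  refine ⟨fun i => if hi : i ∈ F then g ⟨i, hi⟩ else 0, ?_, ⟨i0, i0.2, ?_⟩, ?_, ?_⟩
  · intro i hi; simp [hi]
  · simpa using hi0
  · rw [← Finset.sum_coe_sort]; simpa using h2
  · intro a
    have := congrFun h1 a
    rw [← Finset.sum_coe_sort]; simpa [Finset.sum_apply] using this

lemma st_step {ι : Type*} [DecidableEq ι] {h : ℕ} (x : ι → Fin h → ℚ) (s : Finset ι) :
    ∀ (d : ℕ) (l : ι → ℚ), (s.filter (fun i => l i < 1)).card ≤ d →
      (∀ i ∈ s, 0 ≤ l i ∧ l i ≤ 1) →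
      (∑ i ∈ s, l i = s.card - 1 - h) → (∀ a, ∑ i ∈ s, l i * x i a = 0) →
      ∃ l' : ι → ℚ, (∀ i ∈ s, 0 ≤ l' i ∧ l' i ≤ 1) ∧
      (∑ i ∈ s, l' i = s.card - 1 - h) ∧ (∀ a, ∑ i ∈ s, l' i * x i a = 0) ∧
      ∃ i ∈ s, l' i = 0 := by
  intro d
  induction d with
  | zero =>
    intro l hd hl hs hx
    exfalso
    have h0 : s.filter (fun i => l i < 1) = ∅ := by
      rw [← Finset.card_eq_zero]; omega
    have h1 : ∑ i ∈ s, l i = ∑ i ∈ s, 1 := by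
      apply Finset.sum_congr rfl
      intro i hi
      apply le_antisymm (hl i hi).2
      by_contra hc
      have : i ∈ s.filter (fun i => l i < 1) := by simp [hi]; linarith
      simp [h0] at this
    rw [h1] at hs
    simp at hs
    have : (0:ℚ) ≤ h := by positivity
    linarith
  | succ d ih =>
    intro l hd hl hs hx
    by_cases hz : ∃ i ∈ s, l i = 0
    · exact ⟨l, hl, hs, hx, hz⟩
    push Not at hz
    have hpos : ∀ i ∈ s, 0 < l i := fun i hi => lt_of_le_of_ne (hl i hi).1 (Ne.symm (hz i hi))
    set F := s.filter (fun i => l i < 1) with hFdef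
    have hFs : F ⊆ s := Finset.filter_subset _ _
    have hFm : ∀ i ∈ F, i ∈ s ∧ l i < 1 := fun i hi => by simpa [hFdef] using hi
    have hsum : ∑ i ∈ F, (1 - l i) = h + 1 := by
      have : ∑ i ∈ F, (1 - l i) = ∑ i ∈ s, (1 - l i) := by
        apply Finset.sum_subset hFs
        intro i hi hi2
        have : ¬ l i < 1 := fun hc => hi2 (by simp [hFdef, hi, hc])
        have := (hl i hi).2
        linarith
      rw [this, Finset.sum_sub_distrib, hs]; simp; ring
    have hFne : F.Nonempty := by
      by_contra hc
      rw [Finset.not_nonempty_iff_eq_empty] at hc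
      rw [hc] at hsum
      simp at hsum
      have : (0:ℚ) ≤ h := by positivity
      linarith
    have hFc : h + 1 < F.card := by
      have h1 : ∑ i ∈ F, (1 - l i) < ∑ i ∈ F, (1:ℚ) := by
        apply Finset.sum_lt_sum_of_nonempty hFne
        intro i hi
        have := hpos i (hFs hi)
        linarith
      rw [hsum] at h1
      simp at h1
      exact_mod_cast h1
    obtain ⟨μ, hμ0, ⟨i1, hi1, hμ1⟩, hμs, hμx⟩ := st_dep x F hFc
    let θ : ι → ℚ := fun i => if 0 < μ i then (1 - l i) / μ i else l i / (- μ i)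
    obtain ⟨j, hj, hjmin⟩ := Finset.exists_min_image (F.filter (fun i => μ i ≠ 0)) θ
      ⟨i1, by simp [hi1, hμ1]⟩
    simp only [Finset.mem_filter] at hj hjmin
    have hθj : 0 < θ j := by
      have h1 := hFm j hj.1
      have h2 := hpos j h1.1
      by_cases hc : 0 < μ j
      · simp only [θ, hc, if_true]; apply div_pos <;> linarith
      · have : μ j < 0 := lt_of_le_of_ne (not_lt.mp hc) hj.2
        simp only [θ, hc, if_false]; apply div_pos <;> linarith
    have hsμ : ∑ i ∈ s, μ i = 0 := by
      rw [← hμs]; symm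
      exact Finset.sum_subset hFs (fun i _ hi => hμ0 i hi)
    have hsμx : ∀ a, ∑ i ∈ s, μ i * x i a = 0 := by
      intro a
      rw [← hμx a]; symm
      exact Finset.sum_subset hFs (fun i _ hi => by rw [hμ0 i hi]; ring)
    have hb : ∀ i ∈ s, 0 ≤ l i + θ j * μ i ∧ l i + θ j * μ i ≤ 1 := by
      intro i hi
      have hl' := hl i hi
      by_cases hm : μ i = 0
      · rw [hm]; simpa using hl'
      have hiF : i ∈ F := by by_contra hc; exact hm (hμ0 i hc)
      have hle := hjmin i ⟨hiF, hm⟩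
      by_cases hc : 0 < μ i
      · have e : θ i = (1 - l i) / μ i := by simp only [θ, hc, if_true]
        rw [e, le_div_iff₀ hc] at hle
        constructor
        · have := mul_pos hθj hc; linarith
        · linarith
      · have hneg : μ i < 0 := lt_of_le_of_ne (not_lt.mp hc) hm
        have e : θ i = l i / (- μ i) := by simp only [θ, hc, if_false]
        rw [e, le_div_iff₀ (by linarith)] at hle
        constructor
        · linarith
        · have := mul_pos hθj (neg_pos.mpr hneg); linarith
    by_cases hj0 : l j + θ j * μ j = 0
    · refine ⟨fun i => l i + θ j * μ i, hb, ?_, ?_, j, hFs hj.1, hj0⟩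
      · rw [Finset.sum_add_distrib, ← Finset.mul_sum, hsμ, hs]; ring
      · intro a
        simp only [add_mul, mul_assoc]
        rw [Finset.sum_add_distrib, ← Finset.mul_sum, hsμx, hx]; ring
    · have hj1 : l j + θ j * μ j = 1 := by
        by_cases hc : 0 < μ j
        · have e : θ j = (1 - l j) / μ j := by simp only [θ, hc, if_true]
          rw [e, div_mul_cancel₀ _ hj.2]; ring
        · exfalso; apply hj0
          have e : θ j = l j / (- μ j) := by simp only [θ, hc, if_false]
          rw [e]; have := hj.2; field_simp; ring
      apply ih (fun i => l i + θ j * μ i) _ hb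
      · rw [Finset.sum_add_distrib, ← Finset.mul_sum, hsμ, hs]; ring
      · intro a
        simp only [add_mul, mul_assoc]
        rw [Finset.sum_add_distrib, ← Finset.mul_sum, hsμx, hx]; ring
      · have hsub : s.filter (fun i => l i + θ j * μ i < 1) ⊆ F.erase j := by
          intro i hi
          simp only [Finset.mem_filter] at hi
          rw [Finset.mem_erase]
          constructor
          · rintro rfl; linarith [hi.2]
          · by_contra hc
            have h1 := hi.2
            rw [hμ0 i hc] at h1
            apply hc
            simp only [hFdef, Finset.mem_filter]
            exact ⟨hi.1, by linarith⟩
        have := Finset.card_le_card hsub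
        rw [Finset.card_erase_of_mem hj.1] at this
        omega

/-- `s` is the end of a chain of subsets with small sums. -/
def StGood {ι : Type*} {h : ℕ} (x : ι → Fin h → ℚ) (C : ℚ) (s : Finset ι) : Prop :=
  ∃ f : ℕ → Finset ι, f s.card = s ∧ (∀ i ≤ s.card, (f i).card = i) ∧
    (∀ i j, i ≤ j → j ≤ s.card → f i ⊆ f j) ∧
    ∀ i ≤ s.card, ∀ a, |∑ k ∈ f i, x k a| ≤ C

lemma StGood.insert {ι : Type*} [DecidableEq ι] {h : ℕ} {x : ι → Fin h → ℚ} {C : ℚ}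
    {s : Finset ι} {i0 : ι} (hi : i0 ∈ s) (hg : StGood x C (s.erase i0))
    (hb : ∀ a, |∑ k ∈ s, x k a| ≤ C) : StGood x C s := by
  obtain ⟨f, h1, h2, h3, h4⟩ := hg
  have hc := Finset.card_erase_add_one hi
  refine ⟨fun i => if i ≤ (s.erase i0).card then f i else s, ?_, ?_, ?_, ?_⟩
  · dsimp only; rw [if_neg (by omega)]
  · intro i hi'
    by_cases hc' : i ≤ (s.erase i0).card
    · dsimp only; rw [if_pos hc']; exact h2 i hc'
    · dsimp only; rw [if_neg hc']; omega
  · intro i j hij hj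
    by_cases hc' : j ≤ (s.erase i0).card
    · simp only [if_pos hc', if_pos (hij.trans hc')]; exact h3 i j hij hc'
    · simp only [if_neg hc']
      by_cases hc'' : i ≤ (s.erase i0).card
      · simp only [if_pos hc'']
        refine (h3 i _ hc'' le_rfl).trans ?_
        rw [h1]; exact Finset.erase_subset _ _
      · simp only [if_neg hc'']; exact subset_rfl
  · intro i hi' a
    by_cases hc' : i ≤ (s.erase i0).card
    · dsimp only; rw [if_pos hc']; exact h4 i hc' a
    · dsimp only; rw [if_neg hc']; exact hb a

lemma st_sum_bound {ι : Type*} {h : ℕ} {x : ι → Fin h → ℚ} {B : ℚ}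
    {s : Finset ι} (hx : ∀ i ∈ s, ∀ a, |x i a| ≤ B) (l : ι → ℚ) (hl : ∀ i ∈ s, 0 ≤ l i) (a : Fin h) :
    |∑ i ∈ s, l i * x i a| ≤ (∑ i ∈ s, l i) * B := by
  refine (Finset.abs_sum_le_sum_abs _ _).trans ?_
  rw [Finset.sum_mul]
  apply Finset.sum_le_sum
  intro i hi
  rw [abs_mul, abs_of_nonneg (hl i hi)]
  exact mul_le_mul_of_nonneg_left (hx i hi a) (hl i hi)

lemma st_small {ι : Type*} [DecidableEq ι] {h : ℕ} (x : ι → Fin h → ℚ) (B : ℚ) (hB : 0 ≤ B)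
    (s : Finset ι) : s.card ≤ h → (∀ i ∈ s, ∀ a, |x i a| ≤ B) → StGood x (h * B) s := by
  induction s using Finset.induction_on with
  | empty =>
    intro _ _
    refine ⟨fun _ => ∅, rfl, ?_, ?_, ?_⟩
    · intro i hi; simp at hi; simp [hi]
    · intros; exact subset_rfl
    · intros; simp; positivity
  | insert i s hi ih =>
    intro hc hx
    have hc' := Finset.card_insert_of_notMem hi
    apply StGood.insert (Finset.mem_insert_self i s)
    · rw [Finset.erase_insert hi]
      exact ih (by omega) (fun j hj => hx j (Finset.mem_insert_of_mem hj))
    · intro a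
      have := st_sum_bound hx (fun _ => 1) (fun _ _ => zero_le_one) a
      simp only [one_mul] at this
      refine this.trans (mul_le_mul_of_nonneg_right ?_ hB)
      simpa using (by exact_mod_cast hc : ((insert i s).card : ℚ) ≤ h)

lemma st_chain {ι : Type*} [DecidableEq ι] {h : ℕ} (x : ι → Fin h → ℚ) (B : ℚ) (hB : 0 ≤ B)
    (k : ℕ) : ∀ (s : Finset ι) (l : ι → ℚ), s.card = k + h → (∀ i ∈ s, ∀ a, |x i a| ≤ B) →
      (∀ i ∈ s, 0 ≤ l i ∧ l i ≤ 1) → (∑ i ∈ s, l i = k) → (∀ a, ∑ i ∈ s, l i * x i a = 0) →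
      (∀ a, |∑ i ∈ s, x i a| ≤ h * B) →
      StGood x (h * B) s := by
  induction k with
  | zero => intro s l hs hx _ _ _ _; exact st_small x B hB s (by omega) hx
  | succ k ih =>
    intro s l hs hx hl hsum hlx hb
    have hk : (0:ℚ) < k + 1 := by positivity
    have hq0 : (0:ℚ) ≤ k / (k+1) := by positivity
    have hq1 : (k:ℚ) / (k+1) ≤ 1 := by rw [div_le_one hk]; linarith
    obtain ⟨l', h1, h2, h3, i0, hi0, h4⟩ := st_step x s _ (fun i => (k:ℚ) / (k+1) * l i) le_rfl
      (fun i hi => ⟨mul_nonneg hq0 (hl i hi).1, mul_le_one₀ hq1 (hl i hi).1 (hl i hi).2⟩)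
      (by rw [← Finset.mul_sum, hsum, hs]; push_cast; field_simp; ring)
      (by intro a; simp only [mul_assoc]; rw [← Finset.mul_sum, hlx]; ring)
    have hc := Finset.card_erase_add_one hi0
    have hse : ∑ i ∈ s.erase i0, l' i = k := by
      have := Finset.add_sum_erase s l' hi0
      rw [h4, h2, hs] at this
      push_cast at this
      linarith
    have hxe : ∀ a, ∑ i ∈ s.erase i0, l' i * x i a = 0 := by
      intro a
      have := Finset.add_sum_erase s (fun i => l' i * x i a) hi0
      rw [h3] at this
      simpa [h4] using this
    apply StGood.insert hi0 _ hb
    have hx' : ∀ i ∈ s.erase i0, ∀ a, |x i a| ≤ B := fun i hi => hx i (Finset.mem_of_mem_erase hi)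
    have hl' : ∀ i ∈ s.erase i0, 0 ≤ l' i ∧ l' i ≤ 1 :=
      fun i hi => h1 i (Finset.mem_of_mem_erase hi)
    apply ih (s.erase i0) l' (by omega) hx' hl' hse hxe
    intro a
    have e : ∑ i ∈ s.erase i0, x i a = ∑ i ∈ s.erase i0, (1 - l' i) * x i a := by
      simp only [sub_mul, one_mul, Finset.sum_sub_distrib, hxe, sub_zero]
    rw [e]
    refine (st_sum_bound hx' _ (fun i hi => by linarith [(hl' i hi).2]) a).trans (le_of_eq ?_)
    rw [Finset.sum_sub_distrib, hse]
    have : (s.erase i0).card = k + h := by omega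
    simp [this]

/-- Steinitz lemma, chain form. -/
lemma st_main {ι : Type*} [DecidableEq ι] {h : ℕ} (x : ι → Fin h → ℚ) (B : ℚ) (hB : 0 ≤ B)
    (s : Finset ι) (hx : ∀ i ∈ s, ∀ a, |x i a| ≤ B) (h0 : ∀ a, ∑ i ∈ s, x i a = 0) :
    StGood x (h * B) s := by
  by_cases hc : s.card ≤ h
  · exact st_small x B hB s hc hx
  push Not at hc
  obtain ⟨k, hk⟩ := Nat.exists_eq_add_of_lt hc
  have hp : (0:ℚ) < s.card := by exact_mod_cast (by omega : 0 < s.card)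
  have hle : ((k + 1 : ℕ) : ℚ) ≤ s.card := by exact_mod_cast (by omega)
  apply st_chain x B hB (k+1) s (fun _ => ((k + 1 : ℕ) : ℚ) / s.card) (by omega) hx
  · intro i _
    exact ⟨by positivity, by rw [div_le_one hp]; exact hle⟩
  · simp; field_simp
  · intro a; rw [← Finset.mul_sum, h0]; ring
  · intro a; rw [h0]; simp; positivity

lemma s_abs_le {m : ℕ} {σ : Fin m → ℤ} (hσ : ∑ i, |σ i| ≤ 1) (v : Fin m) : |σ v| ≤ 1 :=
  (Finset.single_le_sum (f := fun i => |σ i|) (fun _ _ => abs_nonneg _) (Finset.mem_univ v)).trans hσ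

lemma s_other {m : ℕ} {σ : Fin m → ℤ} (hσ : ∑ i, |σ i| ≤ 1) {v : Fin m} (hv : σ v ≠ 0)
    {w : Fin m} (hw : w ≠ v) : σ w = 0 := by
  by_contra hc
  have h1 := Finset.add_le_sum (f := fun i => |σ i|) (s := Finset.univ) (fun i _ => abs_nonneg _)
    (Finset.mem_univ w) (Finset.mem_univ v) hw
  have h2 : 1 ≤ |σ v| := Int.one_le_abs hv
  have h3 : 1 ≤ |σ w| := Int.one_le_abs hc
  linarith

lemma s_eq {m : ℕ} {σ τ : Fin m → ℤ} (hσ : ∑ i, |σ i| ≤ 1) (hτ : ∑ i, |τ i| ≤ 1)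
    {v : Fin m} (hv : σ v ≠ 0) (h : σ v = τ v) : σ = τ := by
  funext w
  by_cases hw : w = v
  · rw [hw, h]
  · rw [s_other hσ hv hw, s_other hτ (h ▸ hv) hw]

/-- enumeration of the states -/
def sEnum (m : ℕ) : Option (Fin m × Bool) → (Fin m → ℤ)
  | none => 0
  | some (v, b) => Pi.single v (if b then 1 else -1)

lemma s_mem {m : ℕ} {σ : Fin m → ℤ} (hσ : ∑ i, |σ i| ≤ 1) :
    σ ∈ Finset.univ.image (sEnum m) := by
  rw [Finset.mem_image]
  by_cases h0 : σ = 0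
  · exact ⟨none, Finset.mem_univ _, by simp [sEnum, h0]⟩
  obtain ⟨v, hv⟩ := Function.ne_iff.mp h0
  simp only [Pi.zero_apply] at hv
  have h1 := abs_le.mp (s_abs_le hσ v)
  have h2 : σ v = 1 ∨ σ v = -1 := by omega
  have key : ∀ b : Bool, σ v = (if b then 1 else -1) → sEnum m (some (v, b)) = σ := by
    intro b hb
    funext w
    by_cases hw : w = v
    · subst hw; simp [sEnum, hb]
    · simp [sEnum, hw, s_other hσ hv hw]
  rcases h2 with h2 | h2
  · exact ⟨some (v, true), Finset.mem_univ _, key true (by simpa using h2)⟩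
  · exact ⟨some (v, false), Finset.mem_univ _, key false (by simpa using h2)⟩

lemma s_card (m : ℕ) : (Finset.univ.image (sEnum m)).card ≤ 2 * m + 1 := by
  refine Finset.card_image_le.trans ?_
  simp; omega

/-- minimal nonnegative kernel vectors -/
def MinKer {m n : ℕ} (M : Matrix (Fin m) (Fin n) ℤ) (c : Fin n → ℤ) : Prop :=
  0 ≤ c ∧ c ≠ 0 ∧ M *ᵥ c = 0 ∧ ∀ x : Fin n → ℤ, 0 ≤ x → x ≤ c → M *ᵥ x = 0 → x = 0 ∨ x = c

lemma sum_pos_of_ne {n : ℕ} {c : Fin n → ℤ} (h : 0 ≤ c) (h0 : c ≠ 0) : 0 < ∑ j, c j := by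
  obtain ⟨v, hv⟩ := Function.ne_iff.mp h0
  exact Finset.sum_pos' (fun i _ => h i) ⟨v, Finset.mem_univ _, lt_of_le_of_ne (h v) (Ne.symm hv)⟩

lemma eq_of_le_sum {n : ℕ} {x c : Fin n → ℤ} (h : x ≤ c) (h0 : ∑ j, x j = ∑ j, c j) : x = c := by
  by_contra hne
  have := sum_pos_of_ne (c := c - x) (sub_nonneg.mpr h) (by rw [sub_ne_zero]; exact Ne.symm hne)
  simp at this
  omega

lemma add_single_le {n : ℕ} {x c : Fin n → ℤ} (h : x ≤ c) {j : Fin n} (hj : x j < c j) :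
    x + Pi.single j 1 ≤ c := by
  intro i
  by_cases hi : i = j
  · subst hi; simp; omega
  · simpa [hi] using h i

/-- the invariant of the walk -/
def WalkInv {m n : ℕ} (M : Matrix (Fin m) (Fin n) ℤ) (c : Fin n → ℤ) (σ : Fin m → ℤ)
    (x : Fin n → ℤ) : Prop :=
  0 ≤ x ∧ x ≤ c ∧ ∑ i, |(σ + M *ᵥ x) i| ≤ 1 ∧ (σ = 0 ∨ Odd (∑ i, (σ + M *ᵥ x) i))

lemma even_sum_abs {m : ℕ} (f : Fin m → ℤ) (h : Even (∑ i, |f i|)) : Even (∑ i, f i) := by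
  have : Even (∑ i, |f i| - ∑ i, f i) := by
    rw [← Finset.sum_sub_distrib]
    apply Finset.even_sum
    intro i _
    rcases abs_choice (f i) with h | h <;> rw [h]
    · simp
    · exact ⟨-f i, by ring⟩
  have h2 := h.sub this
  simpa using h2

lemma walk_start {m n : ℕ} (M : Matrix (Fin m) (Fin n) ℤ) (hM : ∀ j, (∑ i, |M i j|) ≤ 2)
    (c : Fin n → ℤ) (hc : MinKer M c) :
    ∃ σ : Fin m → ℤ, (σ = 0 ∨ ((∀ j, 0 < c j → Even (∑ i, M i j)) ∧ Odd (∑ i, σ i))) ∧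
      ∑ i, |σ i| ≤ 1 ∧ ∃ j, 0 < c j ∧ ∑ i, |σ i + M i j| ≤ 1 := by
  by_cases h1 : ∃ j, 0 < c j ∧ ∑ i, |M i j| ≤ 1
  · obtain ⟨j, hj, hj1⟩ := h1
    exact ⟨0, Or.inl rfl, by simp, j, hj, by simpa using hj1⟩
  push Not at h1
  have h2 : ∀ j, 0 < c j → ∑ i, |M i j| = 2 := fun j hj => by
    have := h1 j hj; have := hM j; omega
  obtain ⟨j, hj⟩ := Function.ne_iff.mp hc.2.1
  have hj : 0 < c j := lt_of_le_of_ne (hc.1 j) (Ne.symm hj)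
  obtain ⟨v, hv⟩ : ∃ v, M v j ≠ 0 := by
    by_contra hcon
    push Not at hcon
    have := h2 j hj
    simp [hcon] at this
  have hs : ∃ s : ℤ, (s = 1 ∨ s = -1) ∧ |s + M v j| ≤ |M v j| - 1 := by
    rcases lt_or_gt_of_ne hv with h | h
    · exact ⟨1, Or.inl rfl, by rw [abs_of_neg h, abs_of_nonpos (by omega)]; omega⟩
    · exact ⟨-1, Or.inr rfl, by rw [abs_of_pos h, abs_of_nonneg (by omega)]; omega⟩
  obtain ⟨s, hs, hs2⟩ := hs
  refine ⟨Pi.single v s, Or.inr ⟨fun j hj => even_sum_abs _ (by rw [h2 j hj]; decide), ?_⟩, ?_, j, hj, ?_⟩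
  · rw [Finset.sum_pi_single']
    rcases hs with rfl | rfl <;> simp
  · rw [Finset.sum_eq_single v]
    · rcases hs with rfl | rfl <;> simp
    · intro b _ hb; simp [hb]
    · simp
  · have e : ∑ i, |M i j| = |M v j| + ∑ i ∈ Finset.univ.erase v, |M i j| :=
      (Finset.add_sum_erase _ _ (Finset.mem_univ v)).symm
    rw [← Finset.add_sum_erase _ _ (Finset.mem_univ v)]
    have e2 : ∑ i ∈ Finset.univ.erase v, |(Pi.single v s : Fin m → ℤ) i + M i j|
        = ∑ i ∈ Finset.univ.erase v, |M i j| := by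
      apply Finset.sum_congr rfl
      intro i hi
      simp [Finset.ne_of_mem_erase hi]
    rw [e2]
    simp only [Pi.single_eq_same]
    have := h2 j hj
    omega

lemma walk_ext {m n : ℕ} (M : Matrix (Fin m) (Fin n) ℤ) (hM : ∀ j, (∑ i, |M i j|) ≤ 2)
    (c : Fin n → ℤ) (hc : MinKer M c) (σ : Fin m → ℤ)
    (hσ : σ = 0 ∨ ((∀ j, 0 < c j → Even (∑ i, M i j)) ∧ Odd (∑ i, σ i)))
    (hσ1 : ∑ i, |σ i| ≤ 1) (hst : ∃ j, 0 < c j ∧ ∑ i, |σ i + M i j| ≤ 1)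
    (x : Fin n → ℤ) (hx : WalkInv M c σ x) (hxc : x ≠ c) :
    ∃ j, WalkInv M c σ (x + Pi.single j 1) := by
  obtain ⟨hx0, hx1, hx2, hx3⟩ := hx
  have main : ∃ j, x j < c j ∧ ∑ i, |(σ + M *ᵥ x) i + M i j| ≤ 1 := by
    by_cases hz : x = 0
    · subst hz; simpa using hst
    have hMx : M *ᵥ x ≠ 0 := fun h => by
      rcases hc.2.2.2 x hx0 hx1 h with h | h <;> contradiction
    set τ := σ + M *ᵥ x with hτ
    have hτσ : τ ≠ σ := fun h => hMx (by simpa [hτ] using h)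
    have hτ0 : τ ≠ 0 := by
      rcases hx3 with h | h
      · rw [h] at hτσ; exact hτσ
      · intro h0; rw [h0] at h; simp at h
    obtain ⟨v, hv⟩ := Function.ne_iff.mp hτ0
    simp only [Pi.zero_apply] at hv
    have hne : σ v ≠ τ v := fun h => hτσ (s_eq hx2 hσ1 hv h.symm)
    have b1 := abs_le.mp (s_abs_le hx2 v)
    have b2 := abs_le.mp (s_abs_le hσ1 v)
    have hsum : ∑ j, M v j * (c j - x j) = σ v - τ v := by
      have e1 : (M *ᵥ c) v = 0 := by rw [hc.2.2.1]; rfl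
      have e2 : τ v = σ v + (M *ᵥ x) v := rfl
      simp only [mulVec, dotProduct] at e1 e2
      simp only [mul_sub, Finset.sum_sub_distrib]
      omega
    have hneg : ∑ j, τ v * (M v j * (c j - x j)) < 0 := by
      rw [← Finset.mul_sum, hsum]
      have : τ v = 1 ∨ τ v = -1 := by omega
      rcases this with h | h <;> rw [h] at hne ⊢ <;> omega
    obtain ⟨j, hj⟩ : ∃ j, τ v * (M v j * (c j - x j)) < 0 := by
      by_contra hcon
      push Not at hcon
      have := Finset.sum_nonneg (fun j (_ : j ∈ Finset.univ) => hcon j)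
      omega
    have hj0 : 0 ≤ c j - x j := sub_nonneg.mpr (hx1 j)
    have hj1 : 0 < c j - x j := by
      apply lt_of_le_of_ne hj0; intro h; rw [← h] at hj; simp at hj
    have hj2 : τ v * M v j < 0 := by
      by_contra hcon
      push Not at hcon
      have := mul_nonneg hcon hj0
      rw [mul_assoc] at this
      omega
    refine ⟨j, by omega, ?_⟩
    have h3 : |τ v + M v j| ≤ |τ v| + |M v j| - 2 := by
      have : τ v = 1 ∨ τ v = -1 := by omega
      rcases this with h | h <;> rw [h] at hj2 ⊢
      · rw [abs_of_neg (a := M v j) (by omega), abs_of_nonpos (by omega)]; simp; omega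
      · rw [abs_of_pos (a := M v j) (by omega), abs_of_nonneg (by omega)]; simp; omega
    have h4 : ∑ i ∈ Finset.univ.erase v, |τ i + M i j| ≤
        ∑ i ∈ Finset.univ.erase v, (|τ i| + |M i j|) :=
      Finset.sum_le_sum (fun i _ => abs_add_le _ _)
    rw [Finset.sum_add_distrib] at h4
    have e1 := Finset.add_sum_erase Finset.univ (fun i => |τ i|) (Finset.mem_univ v)
    have e2 := Finset.add_sum_erase Finset.univ (fun i => |M i j|) (Finset.mem_univ v)
    have e3 := Finset.add_sum_erase Finset.univ (fun i => |τ i + M i j|) (Finset.mem_univ v)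
    have := hM j
    linarith
  obtain ⟨j, hj, hj2⟩ := main
  have e : ∀ i, (σ + M *ᵥ (x + Pi.single j 1)) i = (σ + M *ᵥ x) i + M i j := by
    intro i; rw [mulVec_add]; simp [add_assoc]
  refine ⟨j, ?_, add_single_le hx1 hj, ?_, ?_⟩
  · exact add_nonneg hx0 (Pi.single_nonneg.mpr zero_le_one)
  · simpa only [e] using hj2
  · rcases hσ with h | h
    · exact Or.inl h
    · right
      rcases hx3 with h' | h'
      · rw [h'] at h; simp at h
      · simp only [e, Finset.sum_add_distrib (g := fun i => M i j)]
        exact h'.add_even (h.1 j (lt_of_le_of_lt (hx0 j) hj))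

lemma minker_bounds {m n : ℕ} (M : Matrix (Fin m) (Fin n) ℤ) (hM : ∀ j, (∑ i, |M i j|) ≤ 2)
    (c : Fin n → ℤ) (hc : MinKer M c) : (∑ j, c j ≤ 2 * m + 1) ∧ ∀ j, c j ≤ 2 := by
  obtain ⟨σ, hσ, hσ1, hst⟩ := walk_start M hM c hc
  have hext := walk_ext M hM c hc σ hσ hσ1 hst
  have hF : ∀ x : Fin n → ℤ, ∃ j : Fin n, WalkInv M c σ x → x ≠ c →
      WalkInv M c σ (x + Pi.single j 1) := by
    intro x
    by_cases h : WalkInv M c σ x ∧ x ≠ c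
    · obtain ⟨j, hj⟩ := hext x h.1 h.2
      exact ⟨j, fun _ _ => hj⟩
    · obtain ⟨j, -⟩ := hst
      exact ⟨j, fun h1 h2 => absurd ⟨h1, h2⟩ h⟩
  choose J hJ using hF
  let X : ℕ → (Fin n → ℤ) := fun k => Nat.rec 0 (fun _ x => x + Pi.single (J x) 1) k
  have hXs : ∀ k, X (k+1) = X k + Pi.single (J (X k)) 1 := fun k => rfl
  have hX0 : X 0 = 0 := rfl
  have hXsum : ∀ k, ∑ j, X k j = k := by
    intro k
    induction k with
    | zero => simp [hX0]
    | succ k ih => rw [hXs]; simp [Finset.sum_add_distrib, ih]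
  have hcpos := sum_pos_of_ne hc.1 hc.2.1
  obtain ⟨N, hN⟩ := Int.eq_ofNat_of_zero_le hcpos.le
  have hinv : ∀ k, k ≤ N → WalkInv M c σ (X k) := by
    intro k
    induction k with
    | zero =>
      intro _
      refine ⟨le_rfl, hc.1, by simpa [hX0] using hσ1, ?_⟩
      rcases hσ with h | h
      · exact Or.inl h
      · right; simpa [hX0] using h.2
    | succ k ih =>
      intro hk
      rw [hXs]
      apply hJ _ (ih (by omega))
      intro h
      have := hXsum k
      rw [h, hN] at this
      have : N = k := by exact_mod_cast this
      omega
  have hXN : X N = c := eq_of_le_sum (hinv N le_rfl).2.1 (by rw [hXsum, hN])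
  have hmono : Monotone X := monotone_nat_of_le_succ (fun k => by
    rw [hXs]; exact le_add_of_nonneg_right (Pi.single_nonneg.mpr zero_le_one))
  have hinj : ∀ i j, i < j → j ≤ N → M *ᵥ X i = M *ᵥ X j → i = 0 ∧ j = N := by
    intro i j hij hj he
    have hd := hc.2.2.2 (X j - X i) (sub_nonneg.mpr (hmono hij.le)) 
      ((sub_le_self _ (hinv i (by omega)).1).trans (hinv j hj).2.1)
      (by rw [mulVec_sub, he, sub_self])
    have hs : ∑ k, (X j - X i) k = (j:ℤ) - i := by simp [hXsum]
    rcases hd with h | h <;> rw [h] at hs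
    · simp at hs; omega
    · rw [hN] at hs
      omega
  constructor
  · rw [hN]
    have : (Finset.range N).card ≤ (Finset.univ.image (sEnum m)).card := by
      apply Finset.card_le_card_of_injOn (fun k => σ + M *ᵥ X k)
      · intro k hk
        simp only [Finset.coe_range, Set.mem_Iio] at hk
        exact s_mem (hinv k hk.le).2.2.1
      · intro i hi j hj he
        simp only [Finset.coe_range, Set.mem_Iio] at hi hj
        have he : M *ᵥ X i = M *ᵥ X j := add_left_cancel he
        rcases lt_trichotomy i j with h | h | h
        · have := hinj i j h hj.le he; omega
        · exact h
        · have := hinj j i h hi.le he.symm; omega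
    rw [Finset.card_range] at this
    have := this.trans (s_card m)
    simpa using (by exact_mod_cast this : (N:ℤ) ≤ 2 * m + 1)
  · intro j
    by_cases h0 : ∀ v, M v j = 0
    · by_cases hcj : c j ≤ 0
      · omega
      have := hc.2.2.2 (Pi.single j 1) (Pi.single_nonneg.mpr zero_le_one)
        (by simpa using add_single_le hc.1 (j := j) (by simpa using hcj))
        (by ext v; simp [h0])
      rcases this with h | h
      · have := congrFun h j; simp at this
      · rw [← h]; simp
    push Not at h0
    obtain ⟨v, hv⟩ := h0
    let K := (Finset.range N).filter (fun k => J (X k) = j)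
    have hK : ∀ k, X k j = ((Finset.range k).filter (fun k => J (X k) = j)).card := by
      intro k
      induction k with
      | zero => simp [hX0]
      | succ k ih =>
        rw [hXs, Finset.range_add_one, Finset.filter_insert]
        by_cases h : J (X k) = j
        · rw [if_pos h, Finset.card_insert_of_notMem (by simp)]
          simp [ih, h]
        · rw [if_neg h, Pi.add_apply, ih, Pi.single_eq_of_ne (Ne.symm h)]
          simp
    have hcK : c j = K.card := by rw [← hXN]; exact hK N
    let T : ℕ → Fin m → ℤ := fun k => σ + M *ᵥ X k
    have hT : ∀ k, k ≤ N → ∑ i, |T k i| ≤ 1 := fun k hk => (hinv k hk).2.2.1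
    have hTs : ∀ k ∈ K, T (k+1) v = T k v + M v j := by
      intro k hk
      have : J (X k) = j := (Finset.mem_filter.mp hk).2
      simp only [T, hXs, mulVec_add, this]
      simp [add_assoc]
    obtain ⟨ε, hε, hεM⟩ : ∃ ε : ℤ, (ε = 1 ∨ ε = -1) ∧ 0 < ε * M v j := by
      rcases lt_or_gt_of_ne hv with h | h
      · exact ⟨-1, Or.inr rfl, by omega⟩
      · exact ⟨1, Or.inl rfl, by omega⟩
    have hsub : K ⊆ (Finset.range N).filter (fun k => T k v = -ε) ∪
        (Finset.range N).filter (fun k => T (k+1) v = ε) := by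
      intro k hk
      have h1 := hTs k hk
      have h2 := (Finset.mem_filter.mp hk).1
      have h3 := Finset.mem_range.mp h2
      have h4 := abs_le.mp (s_abs_le (hT k h3.le) v)
      have h5 := abs_le.mp (s_abs_le (hT (k+1) h3) v)
      simp only [Finset.mem_union, Finset.mem_filter, h2, true_and]
      rcases hε with rfl | rfl <;> omega
    have hc1 : ((Finset.range N).filter (fun k => T k v = -ε)).card ≤ 1 := by
      rw [Finset.card_le_one]
      have aux : ∀ a b, a < b → b < N → T a v = -ε → T b v = -ε → False := by
        intro a b hab hb h1 h2
        have := s_eq (hT a (by omega)) (hT b (by omega)) (v := v)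
          (by rw [h1]; rcases hε with rfl | rfl <;> decide) (by rw [h1, h2])
        have := hinj a b hab hb.le (by simpa [T] using this)
        omega
      intro a ha b hb
      simp only [Finset.mem_filter, Finset.mem_range] at ha hb
      rcases lt_trichotomy a b with h | h | h
      · exact (aux a b h hb.1 ha.2 hb.2).elim
      · exact h
      · exact (aux b a h ha.1 hb.2 ha.2).elim
    have hc2 : ((Finset.range N).filter (fun k => T (k+1) v = ε)).card ≤ 1 := by
      rw [Finset.card_le_one]
      have aux : ∀ a b, a < b → b < N → T (a+1) v = ε → T (b+1) v = ε → False := by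
        intro a b hab hb h1 h2
        have := s_eq (hT (a+1) (by omega)) (hT (b+1) (by omega)) (v := v)
          (by rw [h1]; rcases hε with rfl | rfl <;> decide) (by rw [h1, h2])
        have := hinj (a+1) (b+1) (by omega) hb (by simpa [T] using this)
        omega
      intro a ha b hb
      simp only [Finset.mem_filter, Finset.mem_range] at ha hb
      rcases lt_trichotomy a b with h | h | h
      · exact (aux a b h hb.1 ha.2 hb.2).elim
      · exact h
      · exact (aux b a h ha.1 hb.2 ha.2).elim
    have := (Finset.card_le_card hsub).trans (Finset.card_union_le _ _)
    rw [hcK]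
    exact_mod_cast (by omega : K.card ≤ 2)

lemma decomp {m n : ℕ} (M : Matrix (Fin m) (Fin n) ℤ) (d : ℕ) :
    ∀ g : Fin n → ℤ, 0 ≤ g → M *ᵥ g = 0 → ∑ j, g j ≤ d →
      ∃ (N : ℕ) (c : Fin N → Fin n → ℤ), (∀ i, MinKer M (c i)) ∧ ∑ i, c i = g := by
  induction d using Nat.strong_induction_on with
  | _ d ih =>
    intro g hg hMg hd
    by_cases h0 : g = 0
    · exact ⟨0, fun _ => 0, fun i => i.elim0, by simp [h0]⟩
    by_cases hmin : MinKer M g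
    · exact ⟨1, fun _ => g, fun _ => hmin, by simp⟩
    have : ∃ x : Fin n → ℤ, 0 ≤ x ∧ x ≤ g ∧ M *ᵥ x = 0 ∧ x ≠ 0 ∧ x ≠ g := by
      by_contra hcon
      push Not at hcon
      refine hmin ⟨hg, h0, hMg, fun x h1 h2 h3 => ?_⟩
      by_contra h4
      push Not at h4
      exact h4.2 (hcon x h1 h2 h3 h4.1)
    obtain ⟨x, hx0, hxg, hMx, hxne, hxneg⟩ := this
    have p1 := sum_pos_of_ne hx0 hxne
    have p2 := sum_pos_of_ne (sub_nonneg.mpr hxg) (sub_ne_zero.mpr (Ne.symm hxneg))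
    have e : ∑ j, (g - x) j = ∑ j, g j - ∑ j, x j := by simp
    obtain ⟨N1, c1, h1, s1⟩ := ih (d-1) (by omega) x hx0 hMx (by omega)
    obtain ⟨N2, c2, h2, s2⟩ := ih (d-1) (by omega) (g - x) (sub_nonneg.mpr hxg)
      (by rw [mulVec_sub, hMg, hMx, sub_zero]) (by omega)
    refine ⟨N1 + N2, Fin.append c1 c2, ?_, ?_⟩
    · intro i
      refine Fin.addCases (fun i => ?_) (fun i => ?_) i
      · simpa using h1 i
      · simpa using h2 i
    · rw [Fin.sum_univ_add]; simp [s1, s2]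

lemma core {h m n : ℕ} (Δ : ℕ)
    (W : Matrix (Fin h) (Fin n) ℤ) (hW : ∀ i j, |W i j| ≤ (Δ : ℤ))
    (M : Matrix (Fin m) (Fin n) ℤ) (hM : ∀ j, (∑ i, |M i j|) ≤ 2)
    (g : Fin n → ℤ) (hg : 0 ≤ g) (hWg : W *ᵥ g = 0) (hMg : M *ᵥ g = 0)
    (hmin : ∀ x : Fin n → ℤ, 0 ≤ x → x ≤ g → W *ᵥ x = 0 → M *ᵥ x = 0 → x = 0 ∨ x = g) :
    ∀ j, g j ≤ 2 * (2 * (Δ : ℤ) * (h : ℤ) * (2 * (m : ℤ) + 1) + 1) ^ h := by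
  obtain ⟨N, c, hc, hcg⟩ := decomp M (∑ j, g j).toNat g hg hMg (Int.self_le_toNat _)
  have hb := fun i => minker_bounds M hM (c i) (hc i)
  have hcpos : ∀ s : Finset (Fin N), 0 ≤ ∑ i ∈ s, c i :=
    fun s => Finset.sum_nonneg (fun i _ => (hc i).1)
  have hcne : ∀ s : Finset (Fin N), s.Nonempty → ∑ i ∈ s, c i ≠ 0 := by
    rintro s ⟨i, hi⟩ h0
    have := (Finset.sum_eq_zero_iff_of_nonneg (fun i _ => (hc i).1)).mp h0 i hi
    exact (hc i).2.1 this
  have hWc : ∀ i a, |(W *ᵥ c i) a| ≤ Δ * (2 * m + 1) := by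
    intro i a
    simp only [mulVec, dotProduct]
    refine (Finset.abs_sum_le_sum_abs _ _).trans ?_
    calc ∑ j, |W a j * c i j| ≤ ∑ j, (Δ : ℤ) * c i j := by
          apply Finset.sum_le_sum
          intro j _
          rw [abs_mul, abs_of_nonneg ((hc i).1 j)]
          exact mul_le_mul_of_nonneg_right (hW a j) ((hc i).1 j)
      _ = Δ * ∑ j, c i j := by rw [Finset.mul_sum]
      _ ≤ _ := mul_le_mul_of_nonneg_left (hb i).1 (by positivity)
  have hWsum : ∀ (s : Finset (Fin N)), W *ᵥ (∑ i ∈ s, c i) = ∑ i ∈ s, W *ᵥ c i := by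
    intro s; exact map_sum (Matrix.mulVecLin W) _ _
  have hMsum : ∀ (s : Finset (Fin N)), M *ᵥ (∑ i ∈ s, c i) = 0 := by
    intro s
    have : M *ᵥ (∑ i ∈ s, c i) = ∑ i ∈ s, M *ᵥ c i := map_sum (Matrix.mulVecLin M) _ _
    rw [this]
    exact Finset.sum_eq_zero (fun i _ => (hc i).2.2.1)
  obtain ⟨f, f1, f2, f3, f4⟩ := st_main (fun i a => (((W *ᵥ c i) a : ℤ) : ℚ))
    (Δ * (2 * m + 1)) (by positivity) Finset.univ
    (fun i _ a => by exact_mod_cast hWc i a)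
    (fun a => by
      have := congrFun (hWsum Finset.univ) a
      rw [hcg, hWg] at this
      rw [Finset.sum_apply] at this
      exact_mod_cast this.symm)
  simp only [Finset.card_univ, Fintype.card_fin] at f1 f2 f3 f4
  set L : ℤ := h * (Δ * (2 * m + 1)) with hL
  have hL0 : 0 ≤ L := by positivity
  let box : Finset (Fin h → ℤ) := Fintype.piFinset (fun _ => Finset.Icc (-L) L)
  have hbox : (box.card : ℤ) = (2 * (Δ : ℤ) * (h : ℤ) * (2 * (m : ℤ) + 1) + 1) ^ h := by
    simp only [box, Fintype.card_piFinset, Finset.prod_const, Int.card_Icc, Finset.card_univ,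
      Fintype.card_fin]
    push_cast
    rw [Int.toNat_of_nonneg (by omega), hL]
    ring
  have hinj : ∀ i j, i < j → j < N → ∑ k ∈ f i, W *ᵥ c k = ∑ k ∈ f j, W *ᵥ c k → False := by
    intro i j hij hj he
    have hsub := f3 i j hij.le hj.le
    have hW0 : W *ᵥ (∑ k ∈ f j \ f i, c k) = 0 := by
      rw [hWsum]
      have := Finset.sum_sdiff (f := fun k => W *ᵥ c k) hsub
      rw [he] at this
      simpa using this
    have hcompl : ∑ k ∈ (f j \ f i)ᶜ, c k + ∑ k ∈ f j \ f i, c k = g := by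
      rw [Finset.sum_compl_add_sum, hcg]
    have hle : ∑ k ∈ f j \ f i, c k ≤ g := by
      rw [← hcompl]; exact le_add_of_nonneg_left (hcpos _)
    rcases hmin _ (hcpos _) hle hW0 (hMsum _) with h | h
    · refine hcne _ ?_ h
      rw [← Finset.card_pos, Finset.card_sdiff_of_subset hsub, f2 i (by omega), f2 j hj.le]
      omega
    · rw [h] at hcompl
      refine hcne (f j \ f i)ᶜ ?_ (by simpa using hcompl)
      rw [← Finset.card_pos, Finset.card_compl, Finset.card_sdiff_of_subset hsub,
        f2 i (by omega), f2 j hj.le, Fintype.card_fin]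
      omega
  have hN : N ≤ box.card := by
    have : (Finset.range N).card ≤ box.card := by
      apply Finset.card_le_card_of_injOn (fun k => ∑ i ∈ f k, W *ᵥ c i)
      · intro k hk
        simp only [Finset.coe_range, Set.mem_Iio] at hk
        simp only [box, Finset.mem_coe, Fintype.mem_piFinset, Finset.mem_Icc]
        intro a
        rw [← abs_le, Finset.sum_apply]
        have := f4 k hk.le a
        rw [hL]
        exact_mod_cast this
      · intro i hi j hj he
        simp only [Finset.coe_range, Set.mem_Iio] at hi hj
        rcases lt_trichotomy i j with h | h | h
        · exact (hinj i j h hj he).elim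
        · exact h
        · exact (hinj j i h hi he.symm).elim
    simpa using this
  intro j
  rw [← hbox, ← hcg, Finset.sum_apply]
  calc ∑ i, c i j ≤ ∑ i : Fin N, (2 : ℤ) := Finset.sum_le_sum (fun i _ => (hb i).2 j)
    _ = 2 * N := by simp [mul_comm]
    _ ≤ _ := by
      have : (N : ℤ) ≤ box.card := by exact_mod_cast hN
      linarith

theorem statement12 {h m n : ℕ} (Δ : ℕ)
    (W : Matrix (Fin h) (Fin n) ℤ) (hW : ∀ i j, |W i j| ≤ (Δ : ℤ))
    (M : Matrix (Fin m) (Fin n) ℤ) (hM : ∀ j, (∑ i, |M i j|) ≤ 2)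
    (A : Matrix (Fin h ⊕ Fin m) (Fin n) ℤ)
    (hA : ∀ j, (∀ i, A (Sum.inl i) j = W i j) ∧ (∀ i, A (Sum.inr i) j = M i j))
    (g : Fin n → ℤ) (hg : IsGraverElement A g) :
    ∀ j, |g j| ≤ 2 * (2 * (Δ : ℤ) * (h : ℤ) * (2 * (m : ℤ) + 1) + 1) ^ h := by
  obtain ⟨hg0, hAg, hgmin⟩ := hg
  let e : Fin n → ℤ := fun j => if 0 ≤ g j then 1 else -1
  have he : ∀ j, e j = 1 ∨ e j = -1 := fun j => by
    simp only [e]; split_ifs <;> simp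
  have hee : ∀ j, e j * e j = 1 := fun j => by rcases he j with h | h <;> rw [h] <;> rfl
  have habs : ∀ j, |e j| = 1 := fun j => by rcases he j with h | h <;> rw [h] <;> rfl
  have heg : ∀ j, e j * |g j| = g j := fun j => by
    simp only [e]; split_ifs with hh
    · rw [abs_of_nonneg hh, one_mul]
    · rw [abs_of_neg (by omega)]; ring
  have key : ∀ x : Fin n → ℤ, (Matrix.of (fun i j => W i j * e j)) *ᵥ x = 0 →
      (Matrix.of (fun i j => M i j * e j)) *ᵥ x = 0 → A *ᵥ (fun j => e j * x j) = 0 := by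
    intro x h1 h2
    funext i
    rcases i with i | i
    · have := congrFun h1 i
      simp only [mulVec, dotProduct, Matrix.of_apply, Pi.zero_apply] at this ⊢
      rw [← this]
      exact Finset.sum_congr rfl (fun j _ => by rw [(hA j).1 i]; ring)
    · have := congrFun h2 i
      simp only [mulVec, dotProduct, Matrix.of_apply, Pi.zero_apply] at this ⊢
      rw [← this]
      exact Finset.sum_congr rfl (fun j _ => by rw [(hA j).2 i]; ring)
  refine core Δ (Matrix.of (fun i j => W i j * e j)) ?_ (Matrix.of (fun i j => M i j * e j)) ?_
    (fun j => |g j|) (fun j => abs_nonneg _) ?_ ?_ ?_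
  · intro i j
    simpa [abs_mul, habs] using hW i j
  · intro j
    simpa [abs_mul, habs] using hM j
  · funext i
    have := congrFun hAg (Sum.inl i)
    simp only [mulVec, dotProduct, Matrix.of_apply, Pi.zero_apply] at this ⊢
    rw [← this]
    exact Finset.sum_congr rfl (fun j _ => by rw [(hA j).1 i, mul_assoc, heg])
  · funext i
    have := congrFun hAg (Sum.inr i)
    simp only [mulVec, dotProduct, Matrix.of_apply, Pi.zero_apply] at this ⊢
    rw [← this]
    exact Finset.sum_congr rfl (fun j _ => by rw [(hA j).2 i, mul_assoc, heg])
  · intro x hx0 hxg hWx hMx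
    by_contra hcon
    push Not at hcon
    obtain ⟨hc1, hc2⟩ := hcon
    refine hgmin (fun j => e j * x j) ?_ ?_ (key x hWx hMx) ?_
    · intro h0
      apply hc1
      funext j
      have := congrFun h0 j
      simp only [Pi.zero_apply] at this ⊢
      calc x j = e j * (e j * x j) := by rw [← mul_assoc, hee, one_mul]
        _ = 0 := by rw [this, mul_zero]
    · intro h0
      apply hc2
      funext j
      have := congrFun h0 j
      rw [← this, abs_mul, habs, one_mul, abs_of_nonneg (hx0 j)]
    · intro j
      constructor
      · rw [abs_mul, habs, one_mul, abs_of_nonneg (hx0 j)]; exact hxg j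
      · have : e j * x j * g j = x j * |g j| := by
          calc e j * x j * g j = e j * x j * (e j * |g j|) := by rw [heg]
            _ = (e j * e j) * (x j * |g j|) := by ring
            _ = _ := by rw [hee, one_mul]
        rw [this]
        exact mul_nonneg (hx0 j) (abs_nonneg _)
end
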